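/- arXiv:2103.04597 — 2 statements merged into one kernel-verified Lean document; each statement's English description precedes it below -/
import Mathlib

section
/- Let G be a finite group and N a normal subgroup such that G/N has prime order. Let σ be an automorphism of G stabilizing N, and let χ be an irreducible complex character of G whose restriction to N is σ-stable. If the restriction of χ to N is reducible, or if there exists g ∈ G \ N with χ(g) ≠ 0 and (σχ)(g) = χ(g), then σ fixes χ. -/
/-- `χ` is the character of an irreducible (simple) finite-dimensional complex
representation of `H`. -/
def IsIrrChar (H : Type) [Group H] (χ : H → ℂ) : Prop :=
  ∃ V : FDRep ℂ H, CategoryTheory.Simple V ∧ χ = FDRep.character V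

open CategoryTheory Module

/-- A subgroup that properly contains a subgroup of prime index is the whole group. -/
theorem Subgroup.eq_top_of_prime_index {G : Type*} [Group G] {N H : Subgroup G}
    (hp : N.index.Prime) (hNH : N ≤ H) {g : G} (hgH : g ∈ H) (hgN : g ∉ N) : H = ⊤ := by
  rw [← Subgroup.index_eq_one]
  rcases (Nat.dvd_prime hp).1 (Subgroup.index_dvd_of_le hNH) with h | h
  · exact h
  · have hmul := Subgroup.relIndex_mul_index hNH
    rw [h] at hmul
    have hrel : N.relIndex H = 1 := Nat.eq_of_mul_eq_mul_right hp.pos (by simpa using hmul)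
    exact absurd (Subgroup.relIndex_eq_one.1 hrel hgH) hgN

/-- An endomorphism of finite order with no eigenvalue other than `1` is the identity. -/
theorem Module.End.eq_one_of_pow_eq_one {W : Type*} [AddCommGroup W] [Module ℂ W]
    [FiniteDimensional ℂ W] (A : End ℂ W) {n : ℕ} (hn : n ≠ 0) (hA : A ^ n = 1)
    (h : ∀ μ : ℂ, A.HasEigenvalue μ → μ = 1) : A = 1 := by
  have hsep : (Polynomial.X ^ n - 1 : Polynomial ℂ).Separable :=
    Polynomial.X_pow_sub_one_separable_iff.2 (by exact_mod_cast hn)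
  have hss : A.IsSemisimple :=
    isSemisimple_of_squarefree_aeval_eq_zero hsep.squarefree (by simp [hA])
  have htop : A.eigenspace 1 = ⊤ := by
    rw [eq_top_iff, ← hss.iSup_eigenspace_eq_top]
    refine iSup_le fun μ => ?_
    by_cases hμ : A.HasEigenvalue μ
    · rw [h μ hμ]
    · rw [hasEigenvalue_iff, not_not] at hμ
      simp [hμ]
  ext w
  have hw : w ∈ A.eigenspace 1 := htop ▸ Submodule.mem_top
  simpa [mem_eigenspace_iff] using hw

/-- The invariant subspaces of a simple representation are trivial. -/
theorem FDRep.eq_bot_or_eq_top_of_simple {G : Type} [Group G] (V : FDRep ℂ G) [Simple V]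
    (p : Submodule ℂ V) (hp : ∀ g, ∀ v ∈ p, V.ρ g v ∈ p) : p = ⊥ ∨ p = ⊤ := by
  let f : FDRep.of (Representation.subrepresentation V.ρ p hp) ⟶ V :=
    ⟨InducedCategory.homMk (ModuleCat.ofHom p.subtype), fun g => by ext; rfl⟩
  have hfv (v : p) : f v = (v : V) := rfl
  have hf : Mono f := ConcreteCategory.mono_of_injective f fun v w h => Subtype.ext h
  by_cases h0 : f = 0
  · left
    rw [Submodule.eq_bot_iff]
    intro v hv
    have := hfv ⟨v, hv⟩
    rw [h0] at this
    exact this.symm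
  · right
    have := isIso_of_mono_of_nonzero h0
    rw [Submodule.eq_top_iff']
    intro v
    have hv : f (inv f v) = v := by
      rw [← ConcreteCategory.comp_apply]; simp
    rw [← hv]
    exact (inv f v : p).2

namespace Representation

variable {G V : Type*} [Group G] [AddCommGroup V] [Module ℂ V]

/-- The elements whose actions under `ρ'` and `ρ` are intertwined by `T` up to a scalar in `C`. -/
def scalarIntertwiner (ρ' ρ : Representation ℂ G V) (T : End ℂ V) (C : Subgroup ℂˣ) :
    Subgroup G where
  carrier := {g | ∃ c ∈ C, ρ g * T = (c : ℂ) • (T * ρ' g)}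
  one_mem' := ⟨1, C.one_mem, by simp⟩
  mul_mem' := by
    rintro g h ⟨c, hc, hg⟩ ⟨d, hd, hh⟩
    refine ⟨c * d, C.mul_mem hc hd, ?_⟩
    rw [map_mul, map_mul, mul_assoc, hh, mul_smul_comm, ← mul_assoc, hg, smul_mul_assoc,
      smul_smul, mul_assoc, Units.val_mul, mul_comm (d : ℂ)]
  inv_mem' := by
    rintro g ⟨c, hc, hg⟩
    refine ⟨c⁻¹, C.inv_mem hc, ?_⟩
    have h1 : ρ g⁻¹ * ρ g = 1 := by rw [← map_mul]; simp
    have h2 : ρ' g * ρ' g⁻¹ = 1 := by rw [← map_mul]; simp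
    have h3 : T * ρ' g = ((c⁻¹ : ℂˣ) : ℂ) • (ρ g * T) := by rw [hg, smul_smul]; simp
    calc ρ g⁻¹ * T = ρ g⁻¹ * (T * ρ' g) * ρ' g⁻¹ := by rw [mul_assoc, mul_assoc, h2, mul_one]
      _ = ((c⁻¹ : ℂˣ) : ℂ) • (ρ g⁻¹ * ρ g * (T * ρ' g⁻¹)) := by
        rw [h3, mul_smul_comm, smul_mul_assoc]; simp only [mul_assoc]
      _ = _ := by rw [h1, one_mul]

theorem scalarIntertwiner_eq_top {N : Subgroup G} (hp : N.index.Prime)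
    {ρ' ρ : Representation ℂ G V} {T : End ℂ V} {C : Subgroup ℂˣ}
    (hN : ∀ n ∈ N, ρ n * T = T * ρ' n) {g : G} (hg : g ∉ N) {μ : ℂˣ} (hμ : μ ∈ C)
    (h : ρ g * T = (μ : ℂ) • (T * ρ' g)) : scalarIntertwiner ρ' ρ T C = ⊤ :=
  Subgroup.eq_top_of_prime_index hp (fun n hn => ⟨1, C.one_mem, by simp [hN n hn]⟩)
    ⟨μ, hμ, h⟩ hg

variable [FiniteDimensional ℂ V]

/-- If `ρ'` is irreducible, a nonzero map intertwining `ρ'` and `ρ` up to scalars is invertible. -/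
theorem isUnit_of_scalarIntertwiner_eq_top {ρ' ρ : Representation ℂ G V}
    (hirr : ∀ p : Submodule ℂ V, (∀ g, ∀ v ∈ p, ρ' g v ∈ p) → p = ⊥ ∨ p = ⊤)
    {T : End ℂ V} (hT : T ≠ 0) {C : Subgroup ℂˣ} (h : scalarIntertwiner ρ' ρ T C = ⊤) :
    IsUnit T := by
  rw [LinearMap.isUnit_iff_ker_eq_bot]
  refine (hirr _ fun g v hv => ?_).resolve_right fun h => hT (LinearMap.ker_eq_top.1 h)
  obtain ⟨c, -, hc⟩ : g ∈ scalarIntertwiner ρ' ρ T C := h ▸ Subgroup.mem_top g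
  have := LinearMap.congr_fun hc v
  rw [LinearMap.mem_ker] at hv ⊢
  simpa [hv] using this.symm

omit [FiniteDimensional ℂ V] in
theorem character_eq_smul_of_isUnit {ρ' ρ : Representation ℂ G V} {T : End ℂ V} (hT : IsUnit T)
    {g : G} {c : ℂ} (h : ρ g * T = c • (T * ρ' g)) : ρ.character g = c * ρ'.character g := by
  obtain ⟨u, rfl⟩ := hT
  have : ρ g = c • (u * ρ' g * (u⁻¹ : (End ℂ V)ˣ)) := by
    rw [← smul_mul_assoc, ← h, mul_assoc, Units.mul_inv, mul_one]
  rw [character, this, map_smul, LinearMap.trace_conj, smul_eq_mul, character]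

/-- The endomorphisms commuting with an irreducible representation are scalar. -/
theorem exists_eq_smul_one {ρ : Representation ℂ G V} [Nontrivial V]
    (hirr : ∀ p : Submodule ℂ V, (∀ g, ∀ v ∈ p, ρ g v ∈ p) → p = ⊥ ∨ p = ⊤)
    {T : End ℂ V} (hT : ∀ g, ρ g * T = T * ρ g) : ∃ c : ℂ, T = c • 1 := by
  obtain ⟨c, hc⟩ := End.exists_eigenvalue T
  refine ⟨c, ?_⟩
  have := (hirr (T.eigenspace c) fun g v hv => ?_).resolve_left hc
  · ext v
    have hv : v ∈ T.eigenspace c := this ▸ Submodule.mem_top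
    simpa [End.mem_eigenspace_iff] using hv
  · have h := LinearMap.congr_fun (hT g) v
    rw [End.mem_eigenspace_iff] at hv ⊢
    simpa [hv] using h.symm

/-- The maps `T` intertwining the restrictions to `N` of `ρ'` and `ρ`. -/
noncomputable abbrev intertwinersOn (N : Subgroup G) (ρ' ρ : Representation ℂ G V) : Submodule ℂ (End ℂ V) :=
  invariants ((linHom ρ' ρ).comp N.subtype)

omit [FiniteDimensional ℂ V] in
theorem linHom_apply_eq_smul_iff {ρ' ρ : Representation ℂ G V} {T : End ℂ V} {g : G} {c : ℂ} :
    linHom ρ' ρ g T = c • T ↔ ρ g * T = c • (T * ρ' g) := by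
  have h1 : ρ' g⁻¹ * ρ' g = 1 := by rw [← map_mul]; simp
  have h2 : ρ' g * ρ' g⁻¹ = 1 := by rw [← map_mul]; simp
  change ρ g * (T * ρ' g⁻¹) = c • T ↔ _
  constructor <;> intro h
  · rw [← smul_mul_assoc, ← h, mul_assoc, mul_assoc, h1, mul_one]
  · rw [← mul_assoc, h, smul_mul_assoc, mul_assoc, h2, mul_one]

omit [FiniteDimensional ℂ V] in
theorem mem_intertwinersOn {N : Subgroup G} {ρ' ρ : Representation ℂ G V} {T : End ℂ V} :
    T ∈ intertwinersOn N ρ' ρ ↔ ∀ n ∈ N, ρ n * T = T * ρ' n := by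
  have h (n : G) : linHom ρ' ρ n T = T ↔ ρ n * T = T * ρ' n := by
    simpa using linHom_apply_eq_smul_iff (ρ' := ρ') (ρ := ρ) (T := T) (g := n) (c := 1)
  simp only [mem_invariants, Subtype.forall, MonoidHom.comp_apply, Subgroup.subtype_apply, h]

theorem finrank_intertwinersOn [Finite G] (N : Subgroup G) (ρ' ρ : Representation ℂ G V)
    [Fintype N] : (finrank ℂ (intertwinersOn N ρ' ρ) : ℂ) =
      (Nat.card N : ℂ)⁻¹ * ∑ n : N, ρ'.character (n : G)⁻¹ * ρ.character n := by
  have : Invertible (Nat.card N : ℂ) := invertibleOfNonzero (by exact_mod_cast Nat.card_pos.ne')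
  rw [← card_inv_mul_sum_char_eq_finrank]
  congr 1
  exact Finset.sum_congr rfl fun n _ => char_linHom ρ' ρ n

omit [FiniteDimensional ℂ V] in
/-- An eigenvector of the conjugation action of `g` on `N`-intertwiners. -/
theorem exists_of_hasEigenvalue {N : Subgroup G} [N.Normal] {ρ' ρ : Representation ℂ G V} {g : G}
    {c : ℂ} (hc : End.HasEigenvalue (toInvariants (linHom ρ' ρ) N g) c) :
    ∃ (T : End ℂ V) (μ : ℂˣ), (μ : ℂ) = c ∧ T ≠ 0 ∧ (∀ n ∈ N, ρ n * T = T * ρ' n) ∧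
      ρ g * T = (μ : ℂ) • (T * ρ' g) := by
  obtain ⟨⟨T, hTN⟩, hT⟩ := hc.exists_hasEigenvector
  have hT0 : T ≠ 0 := fun h => hT.2 (Subtype.ext h)
  have hTc : linHom ρ' ρ g T = c • T := congrArg Subtype.val hT.apply_eq_smul
  have hc0 : c ≠ 0 := by
    rintro rfl
    apply hT0
    have h := congrArg (linHom ρ' ρ g⁻¹) hTc
    rw [← Module.End.mul_apply, ← map_mul] at h
    simpa using h
  exact ⟨T, Units.mk0 c hc0, rfl, hT0, mem_intertwinersOn.1 hTN, linHom_apply_eq_smul_iff.1 hTc⟩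

/-- If the restriction to `N` of an irreducible representation has nonscalar endomorphisms, then
its character vanishes outside `N`. -/
theorem character_eq_zero_of_finrank_ne_one [Finite G] [Nontrivial V] {N : Subgroup G} [N.Normal]
    (hp : N.index.Prime) {ρ : Representation ℂ G V}
    (hirr : ∀ p : Submodule ℂ V, (∀ g, ∀ v ∈ p, ρ g v ∈ p) → p = ⊥ ∨ p = ⊤)
    (hN : finrank ℂ (intertwinersOn N ρ ρ) ≠ 1) {g : G} (hg : g ∉ N) : ρ.character g = 0 := by
  by_contra hχ
  have hA : toInvariants (linHom ρ ρ) N g = 1 := by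
    refine End.eq_one_of_pow_eq_one _ (Nat.card_pos (α := G)).ne' ?_ fun c hc => ?_
    · rw [← map_pow, pow_card_eq_one', map_one]
    · obtain ⟨T, μ, rfl, hT0, hTN, hTg⟩ := exists_of_hasEigenvalue hc
      have htop := scalarIntertwiner_eq_top hp hTN hg (Subgroup.mem_top μ) hTg
      have := character_eq_smul_of_isUnit (isUnit_of_scalarIntertwiner_eq_top hirr hT0 htop) hTg
      exact (mul_eq_right₀ hχ).1 this.symm
  refine hN (finrank_eq_one (⟨1, mem_intertwinersOn.2 fun n _ => by simp⟩ : intertwinersOn N ρ ρ)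
    (fun h => one_ne_zero (congrArg Subtype.val h)) ?_)
  rintro ⟨T, hT⟩
  have hTg : linHom ρ ρ g T = (1 : ℂ) • T := by
    rw [one_smul]
    exact congrArg Subtype.val (LinearMap.congr_fun hA ⟨T, hT⟩)
  have htop := scalarIntertwiner_eq_top hp (mem_intertwinersOn.1 hT) hg (Subgroup.one_mem ⊥)
    (linHom_apply_eq_smul_iff.1 hTg)
  obtain ⟨c, hc⟩ := exists_eq_smul_one hirr (T := T) fun x => by
    obtain ⟨c, hc, h⟩ : x ∈ scalarIntertwiner ρ ρ T ⊥ := htop ▸ Subgroup.mem_top x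
    rw [Subgroup.mem_bot.1 hc] at h
    simpa using h
  exact ⟨c, Subtype.ext hc.symm⟩

/-- Two representations, the first irreducible, whose restrictions to `N` are intertwined and
whose characters agree and are nonzero somewhere outside `N` have the same character. -/
theorem character_eq_of_intertwinersOn {N : Subgroup G} [N.Normal]
    (hp : N.index.Prime) {ρ' ρ : Representation ℂ G V}
    (hirr : ∀ p : Submodule ℂ V, (∀ g, ∀ v ∈ p, ρ' g v ∈ p) → p = ⊥ ∨ p = ⊤)
    (hN : finrank ℂ (intertwinersOn N ρ' ρ) ≠ 0) {g : G} (hg : g ∉ N)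
    (hχ : ρ.character g ≠ 0) (h : ρ'.character g = ρ.character g) (x : G) :
    ρ'.character x = ρ.character x := by
  have : Nontrivial (intertwinersOn N ρ' ρ) := nontrivial_of_finrank_pos (Nat.pos_of_ne_zero hN)
  obtain ⟨c, hc⟩ := End.exists_eigenvalue (toInvariants (linHom ρ' ρ) N g)
  obtain ⟨T, μ, rfl, hT0, hTN, hTg⟩ := exists_of_hasEigenvalue hc
  have hunit := isUnit_of_scalarIntertwiner_eq_top hirr hT0
    (scalarIntertwiner_eq_top hp hTN hg (Subgroup.mem_top μ) hTg)
  have hμ := character_eq_smul_of_isUnit hunit hTg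
  rw [h] at hμ
  have hμ1 : μ = 1 := Units.ext ((mul_eq_right₀ hχ).1 hμ.symm)
  have htop := scalarIntertwiner_eq_top hp hTN hg (Subgroup.mem_bot.2 hμ1) hTg
  obtain ⟨c, hc, hx⟩ : x ∈ scalarIntertwiner ρ' ρ T ⊥ := htop ▸ Subgroup.mem_top x
  rw [Subgroup.mem_bot.1 hc] at hx
  simpa using (character_eq_smul_of_isUnit hunit hx).symm

end Representation

/-- **Lemma (FixingReduction).**  Let `G` be finite, `N ⊴ G` of prime index, `σ` an
automorphism of `G` stabilizing `N`, and `χ` an irreducible complex character of `G`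
whose restriction to `N` is `σ`-stable.  If the restriction of `χ` to `N` is
reducible, or if there is `g ∈ G \ N` with `χ g ≠ 0` and `(σχ)(g) = χ(g)`, then
`σ` fixes `χ` (where `(σχ)(x) = χ (σ⁻¹ x)`). -/
theorem fixing_reduction
    (G : Type) [Group G] [Finite G] (N : Subgroup G) [N.Normal]
    (hp : Nat.Prime N.index)
    (σ : G ≃* G) (hσN : ∀ n ∈ N, σ n ∈ N)
    (χ : G → ℂ) (hχ : IsIrrChar G χ)
    (hres : ∀ n ∈ N, χ (σ.symm n) = χ n)
    (hcase : (¬ IsIrrChar ↥N (fun n : ↥N => χ n)) ∨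
      ∃ g : G, g ∉ N ∧ χ g ≠ 0 ∧ χ (σ.symm g) = χ g) :
    ∀ x : G, χ (σ.symm x) = χ x := by
  obtain ⟨V, hV, rfl⟩ := hχ
  have := Fintype.ofFinite N
  have hcard : (Nat.card N : ℂ) ≠ 0 := by exact_mod_cast Nat.card_pos.ne'
  have hirr := V.eq_bot_or_eq_top_of_simple
  have hnt : Nontrivial V := by
    by_contra h
    rw [not_nontrivial_iff_subsingleton] at h
    refine id_nonzero V ?_
    ext v
    exact Subsingleton.elim (α := V) _ _
  rcases hcase with hred | ⟨g, hgN, hχg, hg⟩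
  · have hN : finrank ℂ (Representation.intertwinersOn N V.ρ V.ρ) ≠ 1 := fun h => by
      refine hred ⟨FDRep.of (V.ρ.comp N.subtype), ?_, rfl⟩
      rw [FDRep.simple_iff_char_is_norm_one]
      have hsum := Representation.finrank_intertwinersOn N V.ρ V.ρ
      rw [h, Nat.cast_one, eq_comm, inv_mul_eq_one₀ hcard] at hsum
      rw [hsum]
      exact Finset.sum_congr rfl fun n _ => mul_comm _ _
    have hzero (x : G) (hx : x ∉ N) : V.character x = 0 :=
      Representation.character_eq_zero_of_finrank_ne_one hp hirr hN hx
    intro x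
    by_cases hx : x ∈ N
    · exact hres x hx
    · rw [hzero x hx, hzero _ fun h => hx (by simpa using hσN _ h)]
  · let ρ' : Representation ℂ G V := V.ρ.comp σ.symm.toMonoidHom
    have hirr' (p : Submodule ℂ V) (h : ∀ g, ∀ v ∈ p, ρ' g v ∈ p) : p = ⊥ ∨ p = ⊤ :=
      hirr p fun g v hv => by simpa [ρ'] using h (σ g) v hv
    refine Representation.character_eq_of_intertwinersOn (ρ' := ρ') (ρ := V.ρ) hp hirr' ?_
      hgN hχg hg
    have hfin : finrank ℂ (Representation.intertwinersOn N ρ' V.ρ) =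
        finrank ℂ (Representation.intertwinersOn N V.ρ V.ρ) := by
      rw [← Nat.cast_inj (R := ℂ), Representation.finrank_intertwinersOn,
        Representation.finrank_intertwinersOn]
      congr 1
      exact Finset.sum_congr rfl fun n _ =>
        congrArg (· * V.character n) (hres _ (N.inv_mem n.2))
    rw [hfin]
    refine (finrank_pos_iff_exists_ne_zero.2 ⟨⟨1, Representation.mem_intertwinersOn.2
      fun n _ => by simp⟩, fun h => one_ne_zero (congrArg Subtype.val h)⟩).ne'
end

section
/- Let H = H₁ ∘_Z H₂ be a central product of finite groups over Z, let Uᵢ ⊲ Hᵢ with Z ≤ Uᵢ for i = 1,2, and let ϑᵢ ∈ Irr(Uᵢ) be such that ϑ := ϑ₁ϑ₂ is a well-defined irreducible character of U₁ ∘_Z U₂. If ϑ is invariant under H = H₁ ∘_Z H₂, then each ϑᵢ is invariant under Hᵢ for i = 1,2; moreover ϑ extends to an irreducible character of H if and only if ϑᵢ extends to Hᵢ for i = 1,2. -/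
/-- The character `ϑ` of the subgroup `U` extends to an (irreducible) character
of the overgroup `H`. -/
def ExtendsToIrr {G : Type} [Group G] (U H : Subgroup G) (hUH : U ≤ H)
    (ϑ : ↥U → ℂ) : Prop :=
  ∃ χ : ↥H → ℂ, IsIrrChar ↥H χ ∧ ∀ u : ↥U, χ ⟨(u : G), hUH u.2⟩ = ϑ u

section CharacterLemmas

open Representation Module CategoryTheory

/-- A complex representation of a finite group affords an irreducible character iff its
equivariant endomorphisms form a line. -/
lemma isIrrChar_character_iff {H V : Type} [Group H] [Finite H] [AddCommGroup V] [Module ℂ V]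
    [FiniteDimensional ℂ V] (ρ : Representation ℂ H V) :
    IsIrrChar H ρ.character ↔ finrank ℂ (linHom ρ ρ).invariants = 1 := by
  have := Fintype.ofFinite H
  have key : Simple (FDRep.of ρ) ↔ finrank ℂ (linHom ρ ρ).invariants = 1 := by
    rw [FDRep.simple_iff_end_is_rank_one,
      ← (linHom.invariantsEquivFDRepHom (FDRep.of ρ) (FDRep.of ρ)).finrank_eq]
    rfl
  rw [← key]
  refine ⟨fun ⟨W, hW, h⟩ ↦ ?_, fun h ↦ ⟨FDRep.of ρ, h, rfl⟩⟩
  have h' : (FDRep.of ρ).character = W.character := h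
  rw [FDRep.simple_iff_char_is_norm_one] at hW ⊢
  rwa [h']

lemma IsIrrChar.exists_rep {H : Type} [Group H] {χ : H → ℂ} (h : IsIrrChar H χ) :
    ∃ V : FDRep ℂ H, Representation.character V.ρ = χ := by
  obtain ⟨V, -, rfl⟩ := h
  exact ⟨V, rfl⟩

lemma IsIrrChar.sum_mul_inv {H : Type} [Group H] [Fintype H] {χ : H → ℂ} (h : IsIrrChar H χ) :
    ∑ g : H, χ g * χ g⁻¹ = Nat.card H := by
  obtain ⟨V, hV, rfl⟩ := h
  exact (FDRep.simple_iff_char_is_norm_one V).1 hV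

/-- An irreducible character has nonzero degree. -/
lemma IsIrrChar.apply_one_ne_zero {H : Type} [Group H] [Finite H] {χ : H → ℂ}
    (h : IsIrrChar H χ) : χ 1 ≠ 0 := by
  obtain ⟨V, rfl⟩ := h.exists_rep
  rw [isIrrChar_character_iff] at h
  rw [Representation.char_one, Nat.cast_ne_zero]
  intro h0
  have : Subsingleton V := finrank_zero_iff.1 h0
  rw [finrank_zero_of_subsingleton] at h
  exact zero_ne_one h

/-- Schur's lemma. -/
lemma exists_eq_smul_one_of_commute {H V : Type} [Group H] [Finite H] [AddCommGroup V]
    [Module ℂ V] [FiniteDimensional ℂ V] {ρ : Representation ℂ H V}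
    (hρ : IsIrrChar H ρ.character) (f : V →ₗ[ℂ] V) (hf : ∀ h, Commute (ρ h) f) :
    ∃ c : ℂ, f = c • 1 := by
  have hV : Nontrivial V := by
    rw [← finrank_pos_iff (R := ℂ), Nat.pos_iff_ne_zero, ← Nat.cast_ne_zero (R := ℂ),
      ← Representation.char_one ρ]
    exact hρ.apply_one_ne_zero
  have mem (g : V →ₗ[ℂ] V) (hg : ∀ h, Commute (ρ h) g) : g ∈ (linHom ρ ρ).invariants := by
    intro h
    change ρ h * (g * ρ h⁻¹) = g
    rw [← mul_assoc, (hg h).eq, mul_assoc, ← map_mul, mul_inv_cancel, map_one, mul_one]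
  rw [isIrrChar_character_iff] at hρ
  obtain ⟨c, hc⟩ := (finrank_eq_one_iff_of_nonzero'
    (⟨1, mem 1 fun _ ↦ Commute.one_right _⟩ : (linHom ρ ρ).invariants)
    (fun h ↦ one_ne_zero (congrArg Subtype.val h))).1 hρ ⟨f, mem f hf⟩
  exact ⟨c, (congrArg Subtype.val hc).symm⟩

/-- A representation whose pullback affords an irreducible character affords an irreducible
character. -/
lemma isIrrChar_of_comp {U H V : Type} [Group U] [Finite U] [Group H] [Finite H]
    [AddCommGroup V] [Module ℂ V] [FiniteDimensional ℂ V] (ρ : Representation ℂ H V)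
    (ι : U →* H) (h : IsIrrChar U (fun u ↦ ρ.character (ι u))) : IsIrrChar H ρ.character := by
  have hV : Nontrivial V := by
    rw [← finrank_pos_iff (R := ℂ), Nat.pos_iff_ne_zero, ← Nat.cast_ne_zero (R := ℂ),
      ← Representation.char_one ρ, ← map_one ι]
    exact h.apply_one_ne_zero
  have hU := (isIrrChar_character_iff (ρ.comp ι)).1 h
  rw [isIrrChar_character_iff]
  have hle : (linHom ρ ρ).invariants ≤ (linHom (ρ.comp ι) (ρ.comp ι)).invariants := by
    intro f hf u
    simpa using hf (ι u)
  refine le_antisymm (hU ▸ Submodule.finrank_mono hle) ?_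
  rw [Nat.one_le_iff_ne_zero, ← Nat.pos_iff_ne_zero, finrank_pos_iff_exists_ne_zero]
  refine ⟨⟨1, fun h ↦ ?_⟩, fun h ↦ one_ne_zero (congrArg Subtype.val h)⟩
  change ρ h * (1 * ρ h⁻¹) = 1
  rw [one_mul, ← map_mul, mul_inv_cancel, map_one]

/-- The action of the first factor of a product group on the invariants of the second one. -/
noncomputable def invariantsOfProd {H K X : Type} [Group H] [Group K] [AddCommGroup X]
    [Module ℂ X] (S : Representation ℂ (H × K) X) :
    Representation ℂ H (invariants (S.comp (MonoidHom.inr H K))) :=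
  subrepresentation (S.comp (MonoidHom.inl H K)) _ fun h x hx k ↦ by
    have hc : S (1, k) * S (h, 1) = S (h, 1) * S (1, k) := by simp [← map_mul]
    have hx' : S (1, k) x = x := hx k
    have := LinearMap.congr_fun hc x
    simpa [hx'] using this

lemma character_invariantsOfProd {H K X : Type} [Group H] [Group K] [Fintype K]
    [AddCommGroup X] [Module ℂ X] [FiniteDimensional ℂ X] (S : Representation ℂ (H × K) X)
    (h : H) : (invariantsOfProd S).character h =
      (Nat.card K : ℂ)⁻¹ * ∑ k : K, S.character (h, k) := by
  have : Invertible (Fintype.card K : ℂ) := invertibleOfNonzero (by simp)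
  set P := averageMap (S.comp (MonoidHom.inr H K)) with hP
  have hproj := isProj_averageMap (S.comp (MonoidHom.inr H K))
  set p := invariants (S.comp (MonoidHom.inr H K))
  have hmem (x : X) : (S (h, 1) * P) x ∈ p :=
    (invariantsOfProd S h ⟨P x, hproj.map_mem x⟩).2
  have hres : invariantsOfProd S h = (S (h, 1) * P).restrict (fun x _ ↦ hmem x) := by
    ext x
    have : P x = x := hproj.map_id x x.2
    simp only [LinearMap.coe_restrict_apply, Module.End.mul_apply, this]
    rfl
  rw [Representation.character, hres, LinearMap.trace_restrict_eq_of_forall_mem p _ hmem, hP]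
  simp only [Representation.averageMap, GroupAlgebra.average, map_smul, map_sum,
    Representation.asAlgebraHom_of, mul_smul_comm, Finset.mul_sum, Representation.character,
    smul_eq_mul, invOf_eq_inv, Nat.card_eq_fintype_card, MonoidHom.comp_apply,
    MonoidHom.inr_apply, ← map_mul, Prod.mk_mul_mk, mul_one, one_mul]

/-- If a representation of `K × L` restricts on `U × L` to a product of irreducible characters,
then the first of them extends to `K`. -/
lemma exists_isIrrChar_extension_of_prod {U K L V : Type} [Group U] [Finite U] [Group K]
    [Finite K] [Group L] [Finite L] [AddCommGroup V] [Module ℂ V] [FiniteDimensional ℂ V]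
    (R : Representation ℂ (K × L) V) (ι : U →* K) {ϑ : U → ℂ} {ψ : L → ℂ}
    (hϑ : IsIrrChar U ϑ) (hψ : IsIrrChar L ψ)
    (hR : ∀ u l, R.character (ι u, l) = ϑ u * ψ l) :
    ∃ χ : K → ℂ, IsIrrChar K χ ∧ ∀ u, χ (ι u) = ϑ u := by
  have := Fintype.ofFinite L
  obtain ⟨W, rfl⟩ := hψ.exists_rep
  set S := linHom (MonoidHom.comp W.ρ (MonoidHom.snd K L)) R
  have hχ (u : U) : (invariantsOfProd S).character (ι u) = ϑ u := by
    have hS (l : L) : S.character (ι u, l) =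
        ϑ u * (Representation.character W.ρ l * Representation.character W.ρ l⁻¹) := by
      rw [Representation.char_linHom, hR]
      change Representation.character W.ρ l⁻¹ * _ = _
      ring
    simp only [character_invariantsOfProd, hS, ← Finset.mul_sum, hψ.sum_mul_inv]
    field_simp
  refine ⟨_, isIrrChar_of_comp (invariantsOfProd S) ι ?_, hχ⟩
  simpa only [hχ] using hϑ

/-- A representation of a group factors through a surjection whose kernel acts trivially. -/
lemma exists_rep_comp_of_surjective {P H V : Type} [Group P] [Group H] [AddCommGroup V]
    [Module ℂ V] (R : Representation ℂ P V) (φ : P →* H) (hφ : Function.Surjective φ)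
    (hker : ∀ p, φ p = 1 → R p = 1) :
    ∃ ρ : Representation ℂ H V, ∀ p, ρ (φ p) = R p := by
  have hwd {p q : P} (h : φ p = φ q) : R p = R q := by
    have : R (p * q⁻¹) = 1 := hker _ (by simp [h])
    rw [← inv_mul_cancel_right p q, map_mul, this, one_mul]
  refine ⟨⟨⟨fun h ↦ R (Function.surjInv hφ h), ?_⟩, fun a b ↦ ?_⟩, fun p ↦ ?_⟩
  · exact hker _ (Function.surjInv_eq hφ 1)
  · rw [← map_mul]
    exact hwd (by simp [Function.surjInv_eq hφ])
  · exact hwd (Function.surjInv_eq hφ _)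

end CharacterLemmas

section CentralProduct

variable {G : Type} [Group G] {H₁ H₂ : Subgroup G}

/-- Multiplication `H₁ × H₂ → H₁H₂` for elementwise commuting subgroups. -/
def commutingMul (hcomm : ∀ a ∈ H₁, ∀ b ∈ H₂, a * b = b * a) :
    ↥H₁ × ↥H₂ →* ↥(H₁ ⊔ H₂) :=
  (Subgroup.inclusion le_sup_left).noncommCoprod (Subgroup.inclusion le_sup_right)
    fun a b ↦ Subtype.ext (hcomm a a.2 b b.2)

lemma commutingMul_apply (hcomm : ∀ a ∈ H₁, ∀ b ∈ H₂, a * b = b * a) (p : ↥H₁ × ↥H₂) :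
    (commutingMul hcomm p : G) = p.1 * p.2 :=
  rfl

lemma commutingMul_surjective (hcomm : ∀ a ∈ H₁, ∀ b ∈ H₂, a * b = b * a) :
    Function.Surjective (commutingMul hcomm) := by
  have hr : H₁ ⊔ H₂ ≤ ((H₁ ⊔ H₂).subtype.comp (commutingMul hcomm)).range :=
    sup_le (fun a ha ↦ ⟨(⟨a, ha⟩, 1), by simp [commutingMul_apply]⟩)
      fun b hb ↦ ⟨(1, ⟨b, hb⟩), by simp [commutingMul_apply]⟩
  intro x
  obtain ⟨p, hp⟩ := hr x.2
  exact ⟨p, Subtype.ext hp⟩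

end CentralProduct

/-- **Invariance and extension in central products.**  Let `H = H₁ ∘_Z H₂` be a
central product over `Z = H₁ ⊓ H₂`, let `Uᵢ ⊴ Hᵢ` with `Z ≤ Uᵢ`, and let
`ϑᵢ ∈ Irr(Uᵢ)` be such that `ϑ = ϑ₁ϑ₂` is a well-defined irreducible character of
`U₁ ∘_Z U₂`.  If `ϑ` is invariant under `H = H₁ ∘_Z H₂`, then each `ϑᵢ` is
invariant under `Hᵢ`; moreover `ϑ` extends to `H` iff `ϑᵢ` extends to `Hᵢ` for
`i = 1, 2`. -/
theorem central_product_invariance_and_extension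
    (G : Type) [Group G] [Finite G] (H₁ H₂ U₁ U₂ : Subgroup G)
    (hcomm : ∀ a ∈ H₁, ∀ b ∈ H₂, a * b = b * a)
    (hU₁ : U₁ ≤ H₁) (hU₂ : U₂ ≤ H₂)
    (hZ₁ : H₁ ⊓ H₂ ≤ U₁) (hZ₂ : H₁ ⊓ H₂ ≤ U₂)
    (hnorm₁ : ∀ h ∈ H₁, ∀ u ∈ U₁, h * u * h⁻¹ ∈ U₁)
    (hnorm₂ : ∀ h ∈ H₂, ∀ u ∈ U₂, h * u * h⁻¹ ∈ U₂)
    (ϑ₁ : ↥U₁ → ℂ) (ϑ₂ : ↥U₂ → ℂ)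
    (hϑ₁ : IsIrrChar ↥U₁ ϑ₁) (hϑ₂ : IsIrrChar ↥U₂ ϑ₂)
    (ϑ : ↥(U₁ ⊔ U₂) → ℂ) (hϑ : IsIrrChar ↥(U₁ ⊔ U₂) ϑ)
    (hprod : ∀ (a : G) (ha : a ∈ U₁) (b : G) (hb : b ∈ U₂),
      ϑ ⟨a * b, mul_mem ((le_sup_left : U₁ ≤ U₁ ⊔ U₂) ha)
          ((le_sup_right : U₂ ≤ U₁ ⊔ U₂) hb)⟩
        = ϑ₁ ⟨a, ha⟩ * ϑ₂ ⟨b, hb⟩)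
    (hinv : ∀ h ∈ H₁ ⊔ H₂, ∀ (u : G) (hu : u ∈ U₁ ⊔ U₂)
        (hcu : h⁻¹ * u * h ∈ U₁ ⊔ U₂),
      ϑ ⟨h⁻¹ * u * h, hcu⟩ = ϑ ⟨u, hu⟩) :
    ((∀ h ∈ H₁, ∀ (u : G) (hu : u ∈ U₁) (hcu : h⁻¹ * u * h ∈ U₁),
        ϑ₁ ⟨h⁻¹ * u * h, hcu⟩ = ϑ₁ ⟨u, hu⟩) ∧
      (∀ h ∈ H₂, ∀ (u : G) (hu : u ∈ U₂) (hcu : h⁻¹ * u * h ∈ U₂),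
        ϑ₂ ⟨h⁻¹ * u * h, hcu⟩ = ϑ₂ ⟨u, hu⟩)) ∧
    (ExtendsToIrr (U₁ ⊔ U₂) (H₁ ⊔ H₂) (sup_le_sup hU₁ hU₂) ϑ ↔
      ExtendsToIrr U₁ H₁ hU₁ ϑ₁ ∧ ExtendsToIrr U₂ H₂ hU₂ ϑ₂) := by
  have h₁ := hϑ₁.apply_one_ne_zero
  have h₂ := hϑ₂.apply_one_ne_zero
  have hleft (u : G) (hu : u ∈ U₁) : ϑ ⟨u, le_sup_left (a := U₁) hu⟩ = ϑ₁ ⟨u, hu⟩ * ϑ₂ 1 := by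
    refine Eq.trans ?_ (hprod u hu 1 (one_mem _))
    simp only [mul_one]
  have hright (u : G) (hu : u ∈ U₂) : ϑ ⟨u, le_sup_right (a := U₁) hu⟩ = ϑ₁ 1 * ϑ₂ ⟨u, hu⟩ := by
    refine Eq.trans ?_ (hprod 1 (one_mem _) u hu)
    simp only [one_mul]
  refine ⟨⟨fun h hh u hu hcu ↦ ?_, fun h hh u hu hcu ↦ ?_⟩, ?_, ?_⟩
  · refine mul_right_cancel₀ h₂ ?_
    rw [← hleft, ← hleft]
    exact hinv h (le_sup_left (a := H₁) hh) u _ _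
  · refine mul_left_cancel₀ h₁ ?_
    rw [← hright, ← hright]
    exact hinv h (le_sup_right (a := H₁) hh) u _ _
  · rintro ⟨χ, hχ, hext⟩
    obtain ⟨V, rfl⟩ := hχ.exists_rep
    set R : Representation ℂ (↥H₁ × ↥H₂) V := MonoidHom.comp V.ρ (commutingMul hcomm)
    have hR (a : ↥U₁) (b : ↥U₂) :
        R.character (Subgroup.inclusion hU₁ a, Subgroup.inclusion hU₂ b) = ϑ₁ a * ϑ₂ b := by
      rw [← hprod a a.2 b b.2, ← hext]
      rfl
    constructor
    · exact exists_isIrrChar_extension_of_prod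
        (MonoidHom.comp R ((MonoidHom.id ↥H₁).prodMap (Subgroup.inclusion hU₂)))
        (Subgroup.inclusion hU₁) hϑ₁ hϑ₂ hR
    · exact exists_isIrrChar_extension_of_prod
        (MonoidHom.comp R (((Subgroup.inclusion hU₁).prodMap (MonoidHom.id ↥H₂)).comp
          (MulEquiv.prodComm : ↥H₂ × ↥U₁ ≃* ↥U₁ × ↥H₂).toMonoidHom))
        (Subgroup.inclusion hU₂) hϑ₂ hϑ₁ fun b a ↦ (hR a b).trans (mul_comm _ _)
  · rintro ⟨⟨χ₁, hχ₁, hext₁⟩, ⟨χ₂, hχ₂, hext₂⟩⟩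
    obtain ⟨V₁, rfl⟩ := hχ₁.exists_rep
    obtain ⟨V₂, rfl⟩ := hχ₂.exists_rep
    set R : Representation ℂ (↥H₁ × ↥H₂) (TensorProduct ℂ V₁ V₂) :=
      Representation.tprod (MonoidHom.comp V₁.ρ (MonoidHom.fst ↥H₁ ↥H₂))
        (MonoidHom.comp V₂.ρ (MonoidHom.snd ↥H₁ ↥H₂))
    have hker (p : ↥H₁ × ↥H₂) (hp : commutingMul hcomm p = 1) : R p = 1 := by
      obtain ⟨⟨a, ha⟩, ⟨b, hb⟩⟩ := p
      have hab : a * b = 1 := congrArg Subtype.val hp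
      have ha₂ : a ∈ H₂ := by rw [eq_inv_of_mul_eq_one_left hab]; exact inv_mem hb
      have hb₁ : b ∈ H₁ := by rw [eq_inv_of_mul_eq_one_right hab]; exact inv_mem ha
      obtain ⟨c, hc⟩ := exists_eq_smul_one_of_commute hχ₁ (V₁.ρ ⟨a, ha⟩) fun h ↦ by
        rw [commute_iff_eq, ← map_mul, ← map_mul]
        exact congrArg _ (Subtype.ext (hcomm h h.2 a ha₂))
      obtain ⟨d, hd⟩ := exists_eq_smul_one_of_commute hχ₂ (V₂.ρ ⟨b, hb⟩) fun h ↦ by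
        rw [commute_iff_eq, ← map_mul, ← map_mul]
        exact congrArg _ (Subtype.ext (hcomm b hb₁ h h.2).symm)
      have haU : a ∈ U₁ := hZ₁ ⟨ha, ha₂⟩
      have hbU : b ∈ U₂ := hZ₂ ⟨hb₁, hb⟩
      have hcd : c * d = 1 := by
        have e₁ : ϑ₁ ⟨a, haU⟩ = c * ϑ₁ 1 := by
          rw [← hext₁, ← hext₁]
          refine Eq.trans ?_ (congrArg (c * ·) (Representation.char_one V₁.ρ).symm)
          simp [Representation.character, hc]
        have e₂ : ϑ₂ ⟨b, hbU⟩ = d * ϑ₂ 1 := by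
          rw [← hext₂, ← hext₂]
          refine Eq.trans ?_ (congrArg (d * ·) (Representation.char_one V₂.ρ).symm)
          simp [Representation.character, hd]
        have e := hprod a haU b hbU
        have e' := hleft 1 (one_mem _)
        simp only [hab] at e
        rw [e', e₁, e₂] at e
        change ϑ₁ 1 * ϑ₂ 1 = _ at e
        refine mul_right_cancel₀ (mul_ne_zero h₁ h₂) ?_
        linear_combination -e
      change TensorProduct.map (V₁.ρ ⟨a, ha⟩) (V₂.ρ ⟨b, hb⟩) = 1
      rw [hc, hd, TensorProduct.map_smul_left, TensorProduct.map_smul_right, smul_smul, hcd,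
        one_smul]
      exact TensorProduct.map_id
    obtain ⟨ρ, hρ⟩ := exists_rep_comp_of_surjective R _ (commutingMul_surjective hcomm) hker
    have hext (u : ↥(U₁ ⊔ U₂)) :
        ρ.character (Subgroup.inclusion (sup_le_sup hU₁ hU₂) u) = ϑ u := by
      obtain ⟨⟨a, b⟩, rfl⟩ := commutingMul_surjective
        (fun a ha b hb ↦ hcomm a (hU₁ ha) b (hU₂ hb) : ∀ a ∈ U₁, ∀ b ∈ U₂, a * b = b * a) u
      refine Eq.trans ?_ (hprod a a.2 b b.2).symm
      rw [← hext₁, ← hext₂]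
      refine (congrArg (LinearMap.trace ℂ _)
        (hρ (Subgroup.inclusion hU₁ a, Subgroup.inclusion hU₂ b))).trans ?_
      exact LinearMap.trace_tensorProduct' _ _
    refine ⟨_, isIrrChar_of_comp ρ (Subgroup.inclusion (sup_le_sup hU₁ hU₂)) ?_, hext⟩
    simpa only [hext] using hϑ
end
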